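/- Let F be a field of odd characteristic, A ⊆ F² finite, and suppose A is the disjoint union of B and C where all points of C lie on a single line γ. Let T(A) = Σ_ℓ i_A(ℓ)·b*_A(ℓ) (sum over non-isotropic lines ℓ), where i_A(ℓ) = |A ∩ ℓ| and b*_A(ℓ) = |{a ∈ A ∖ ℓ : reflection of a through ℓ lies in A}|. Then T(A) ≤ T(B) + 8|A|². -/

import Mathlib

open scoped Classical

/-- The (squared-Euclidean) distance in the plane. -/
noncomputable def dist2 {F : Type*} [Field F] (x y : F × F) : F :=
  (x.1 - y.1) ^ 2 + (x.2 - y.2) ^ 2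

/-- The finite set of (non-isotropic) perpendicular bisector lines determined by `A`.
Every non-isotropic line `ℓ` with `b*_A(ℓ) ≠ 0` belongs to this set, so sums of
`i_A(ℓ)·b*_A(ℓ)` over this set agree with sums over all non-isotropic lines. -/
noncomputable def bisectorLines {F : Type*} [Field F] (A : Finset (F × F)) :
    Finset (Set (F × F)) :=
  ((A ×ˢ A).filter fun p => p.1 ≠ p.2 ∧
      (p.1.1 - p.2.1) ^ 2 + (p.1.2 - p.2.2) ^ 2 ≠ 0).image
    fun p => {x : F × F | dist2 p.1 x = dist2 p.2 x}

/-- `i_A(ℓ) = |A ∩ ℓ|`. -/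
noncomputable def iline {F : Type*} [Field F] (A : Finset (F × F)) (l : Set (F × F)) :
    ℕ :=
  (A.filter fun a => a ∈ l).card

/-- `b*_A(ℓ)`: the number of `a ∈ A` outside `ℓ` having a mirror image `a' ∈ A`
with respect to `ℓ`. -/
noncomputable def bstar {F : Type*} [Field F] (A : Finset (F × F)) (l : Set (F × F)) :
    ℕ :=
  (A.filter fun a => a ∉ l ∧
    ∃ a' ∈ A, a' ≠ a ∧ ∀ x ∈ l, dist2 a x = dist2 a' x).card

/-- `T(A) = Σ_ℓ i_A(ℓ)·b*_A(ℓ)`, the sum over non-isotropic lines. -/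
noncomputable def Tsum {F : Type*} [Field F] (A : Finset (F × F)) : ℕ :=
  ∑ l ∈ bisectorLines A, iline A l * bstar A l

section PruningHelpers

variable {F : Type*} [Field F]

/-- The triples `(x, (a, a'))` with `a - a'` non-isotropic and `x` on the bisector. -/
noncomputable def pruneQ (A : Finset (F × F)) : Finset ((F × F) × ((F × F) × (F × F))) :=
  (A ×ˢ (A ×ˢ A)).filter fun t => dist2 t.2.1 t.2.2 ≠ 0 ∧ dist2 t.2.1 t.1 = dist2 t.2.2 t.1

lemma prune_key (h2 : (2 : F) ≠ 0) (p q a a' : F × F) (hpq : dist2 p q ≠ 0)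
    (haa : a' ≠ a) (h : ∀ x, dist2 p x = dist2 q x → dist2 a x = dist2 a' x) :
    ∃ s : F, s ≠ 0 ∧ a.1 - a'.1 = s * (p.1 - q.1) ∧ a.2 - a'.2 = s * (p.2 - q.2) ∧
      ∀ x, dist2 a x - dist2 a' x = s * (dist2 p x - dist2 q x) := by
  obtain ⟨p1, p2⟩ := p
  obtain ⟨q1, q2⟩ := q
  obtain ⟨a1, a2⟩ := a
  obtain ⟨b1, b2⟩ := a'
  have hm := h ((p1 + q1) / 2, (p2 + q2) / 2) (by simp only [dist2]; field_simp; ring)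
  have he := h ((p1 + q1) / 2 - (p2 - q2), (p2 + q2) / 2 + (p1 - q1))
    (by simp only [dist2]; field_simp; ring)
  simp only [dist2] at hm he hpq ⊢
  have horth : (a1 - b1) * (p2 - q2) = (a2 - b2) * (p1 - q1) := by
    apply mul_left_cancel₀ h2
    linear_combination he - hm
  set N := (p1 - q1) ^ 2 + (p2 - q2) ^ 2 with hN
  set s := ((a1 - b1) * (p1 - q1) + (a2 - b2) * (p2 - q2)) / N with hs
  have hsN : s * N = (a1 - b1) * (p1 - q1) + (a2 - b2) * (p2 - q2) := by
    rw [hs]; field_simp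
  have e1 : a1 - b1 = s * (p1 - q1) := by
    apply mul_right_cancel₀ hpq
    rw [mul_right_comm, hsN, hN]
    linear_combination (p2 - q2) * horth
  have e2 : a2 - b2 = s * (p2 - q2) := by
    apply mul_right_cancel₀ hpq
    rw [mul_right_comm, hsN, hN]
    linear_combination (-(p1 - q1)) * horth
  refine ⟨s, ?_, e1, e2, ?_⟩
  · intro h0
    apply haa
    rw [h0] at e1 e2
    ext
    · simp only; linear_combination -e1
    · simp only; linear_combination -e2
  · rintro ⟨x1, x2⟩
    simp only
    have hm' : (a1 ^ 2 + a2 ^ 2 - b1 ^ 2 - b2 ^ 2) =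
        (a1 - b1) * (p1 + q1) + (a2 - b2) * (p2 + q2) := by
      have : ((p1 + q1) / 2) * 2 = p1 + q1 := by field_simp
      have : ((p2 + q2) / 2) * 2 = p2 + q2 := by field_simp
      linear_combination hm + (a1 - b1) * ‹((p1 + q1) / 2) * 2 = p1 + q1›
        + (a2 - b2) * ‹((p2 + q2) / 2) * 2 = p2 + q2›
    linear_combination hm' + (p1 + q1 - 2 * x1) * e1 + (p2 + q2 - 2 * x2) * e2

lemma prune_dist_self (a b : F × F) (h : dist2 a b ≠ 0) : b ≠ a := by
  rintro rfl; simp [dist2] at h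

/-- A point and a bisector determine the mirror image. -/
lemma prune_uniq (h2 : (2 : F) ≠ 0) (a b c : F × F) (hb : dist2 a b ≠ 0) (hc : dist2 a c ≠ 0)
    (h : ∀ x, dist2 a b ≠ 0 → dist2 a x = dist2 b x → dist2 a x = dist2 c x) : b = c := by
  obtain ⟨s, hs, e1, e2, hx⟩ := prune_key h2 a b a c hb (prune_dist_self _ _ hc)
    (fun x => h x hb)
  have h1 := hx a
  have : s = 1 := by
    have h3 : s * (s - 1) * dist2 a b = 0 := by
      simp only [dist2] at h1 ⊢
      linear_combination -h1 - (a.1 - c.1 + s * (a.1 - b.1)) * e1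
        - (a.2 - c.2 + s * (a.2 - b.2)) * e2
    rcases mul_eq_zero.1 h3 with h3 | h3
    · rcases mul_eq_zero.1 h3 with h3 | h3
      · exact absurd h3 hs
      · linear_combination h3
    · exact absurd h3 hb
  rw [this] at e1 e2
  ext
  · linear_combination e1
  · linear_combination e2

lemma prune_T_eq (h2 : (2 : F) ≠ 0) (A : Finset (F × F)) : Tsum A = (pruneQ A).card := by
  have hmaps : ∀ t ∈ pruneQ A,
      (fun t : (F × F) × ((F × F) × (F × F)) => {x : F × F | dist2 t.2.1 x = dist2 t.2.2 x}) t
        ∈ bisectorLines A := by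
    rintro ⟨x, a, b⟩ ht
    simp only [pruneQ, Finset.mem_filter, Finset.mem_product] at ht
    simp only [bisectorLines, Finset.mem_image, Finset.mem_filter, Finset.mem_product]
    exact ⟨(a, b), ⟨ht.1.2, (prune_dist_self _ _ ht.2.1).symm, ht.2.1⟩, rfl⟩
  rw [Finset.card_eq_sum_card_fiberwise hmaps, Tsum]
  refine Finset.sum_congr rfl fun l hl => ?_
  simp only [bisectorLines, Finset.mem_image, Finset.mem_filter, Finset.mem_product] at hl
  obtain ⟨⟨p, q⟩, ⟨_, _, hpq⟩, rfl⟩ := hl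
  rw [iline, bstar, ← Finset.card_product]
  symm
  refine Finset.card_bij (fun t _ => (t.1, t.2.1)) ?_ ?_ ?_
  · rintro ⟨x, a, b⟩ ht
    simp only [pruneQ, Finset.mem_filter, Finset.mem_product] at ht
    obtain ⟨⟨⟨hx, ha, hb⟩, hab, hxab⟩, hl⟩ := ht
    rw [← hl]
    simp only [Finset.mem_filter, Finset.mem_product, Set.mem_ofPred_eq]
    refine ⟨⟨hx, hxab⟩, ha, ?_, b, hb, prune_dist_self _ _ hab, fun x hx => hx⟩
    intro h
    apply hab
    simp only [dist2] at h ⊢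
    linear_combination -h
  · rintro ⟨x, a, b⟩ ht ⟨x', a', b'⟩ ht' heq
    simp only [Prod.mk.injEq] at heq
    obtain ⟨rfl, rfl⟩ := heq
    simp only [pruneQ, Finset.mem_filter, Finset.mem_product] at ht ht'
    have : b = b' := by
      refine prune_uniq h2 a b b' ht.1.2.1 ht'.1.2.1 fun y _ hy => ?_
      have h3 := ht.2.trans ht'.2.symm
      have : y ∈ {x : F × F | dist2 a x = dist2 b x} := hy
      rw [h3] at this
      exact this
    rw [this]
  · rintro ⟨x, a⟩ h
    simp only [Finset.mem_filter, Finset.mem_product, Set.mem_ofPred_eq] at h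
    obtain ⟨⟨hx, hxl⟩, ha, hal, b, hb, hba, hall⟩ := h
    obtain ⟨s, hs, e1, e2, hf⟩ := prune_key h2 p q a b hpq hba hall
    refine ⟨(x, a, b), ?_, rfl⟩
    simp only [pruneQ, Finset.mem_filter, Finset.mem_product]
    refine ⟨⟨⟨hx, ha, hb⟩, ?_, hall x hxl⟩, ?_⟩
    · simp only [dist2]
      rw [e1, e2]
      have : (s * (p.1 - q.1)) ^ 2 + (s * (p.2 - q.2)) ^ 2
        = s ^ 2 * ((p.1 - q.1) ^ 2 + (p.2 - q.2) ^ 2) := by ring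
      rw [this]
      exact mul_ne_zero (pow_ne_zero _ hs) hpq
    · ext y
      simp only [Set.mem_ofPred_eq]
      rw [← sub_eq_zero, hf y, mul_eq_zero, sub_eq_zero]
      simp [hs]

lemma prune_iso (w : F × F) (hw : w ≠ 0) (hW : w.1 ^ 2 + w.2 ^ 2 = 0) (v1 v2 : F)
    (h : w.1 * v1 + w.2 * v2 = 0) : ∃ s : F, v1 = s * w.1 ∧ v2 = s * w.2 := by
  have h1 : w.1 ≠ 0 := by
    intro h0
    apply hw
    rw [h0] at hW
    have h3 : w.2 = 0 := by
      apply pow_eq_zero_iff (two_ne_zero) |>.1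
      linear_combination hW
    exact Prod.ext h0 h3
  refine ⟨v1 / w.1, by field_simp, ?_⟩
  have h2 : w.2 ≠ 0 := by
    intro h0
    rw [h0] at hW
    apply h1
    apply pow_eq_zero_iff (two_ne_zero) |>.1
    linear_combination hW
  field_simp
  apply mul_left_cancel₀ h2
  linear_combination w.1 * h - v1 * hW

/-- Triples with third point on the line. -/
lemma prune_third (h2 : (2 : F) ≠ 0) (A C : Finset (F × F)) (p w : F × F) (hw : w ≠ 0)
    (hC : ∀ c ∈ C, ∃ k : F, c = (p.1 + k * w.1, p.2 + k * w.2)) :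
    ((pruneQ A).filter fun t => t.2.2 ∈ C).card ≤ 3 * A.card ^ 2 := by
  rw [← Finset.card_filter_add_card_filter_not (s := (pruneQ A).filter fun t => t.2.2 ∈ C)
    (fun t => w.1 ^ 2 + w.2 ^ 2 = 0 ∧ w.1 * (p.1 - t.1.1) + w.2 * (p.2 - t.1.2) = 0)]
  have b1 : (((pruneQ A).filter fun t => t.2.2 ∈ C).filter
      (fun t => w.1 ^ 2 + w.2 ^ 2 = 0 ∧ w.1 * (p.1 - t.1.1) + w.2 * (p.2 - t.1.2) = 0)).card
      ≤ (A ×ˢ A).card := by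
    refine Finset.card_le_card_of_injOn (fun t => t.2) ?_ ?_
    · rintro ⟨x, a, b⟩ ht
      simp only [pruneQ, Finset.coe_filter, Finset.mem_filter, Finset.mem_product,
        Set.mem_ofPred_eq] at ht
      simp only [Finset.coe_product, Set.mem_prod, Finset.mem_coe]
      exact ht.1.1.1.2
    · rintro ⟨x, a, b⟩ ht ⟨x', a', b'⟩ ht' heq
      simp only [Prod.mk.injEq] at heq
      obtain ⟨rfl, rfl⟩ := heq
      simp only [pruneQ, Finset.coe_filter, Finset.mem_filter, Finset.mem_product,
        Set.mem_ofPred_eq] at ht ht'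
      obtain ⟨⟨⟨_, hab, hx⟩, hbC⟩, hW, hu⟩ := ht
      obtain ⟨⟨⟨_, _, hx'⟩, _⟩, _, hu'⟩ := ht'
      obtain ⟨k, rfl⟩ := hC b hbC
      have hxx : x = x' := by
        obtain ⟨m, m1, m2⟩ := prune_iso w hw hW (p.1 - x.1) (p.2 - x.2) hu
        obtain ⟨n, n1, n2⟩ := prune_iso w hw hW (p.1 - x'.1) (p.2 - x'.2) hu'
        have q1 : x.1 = p.1 - m * w.1 := by linear_combination -m1
        have q2 : x.2 = p.2 - m * w.2 := by linear_combination -m2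
        have r1 : x'.1 = p.1 - n * w.1 := by linear_combination -n1
        have r2 : x'.2 = p.2 - n * w.2 := by linear_combination -n2
        simp only [dist2] at hab hx hx'
        rw [q1, q2] at hx
        rw [r1, r2] at hx'
        have hmn : 2 * ((m - n) * (w.1 * (a.1 - p.1) + w.2 * (a.2 - p.2))) = 0 := by
          linear_combination hx - hx' + ((k + m) ^ 2 - (k + n) ^ 2 - m ^ 2 + n ^ 2) * hW
        rcases mul_eq_zero.1 ((mul_eq_zero.1 hmn).resolve_left h2) with h | h
        · have : m = n := sub_eq_zero.1 h
          ext
          · rw [q1, r1, this]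
          · rw [q2, r2, this]
        · exfalso
          obtain ⟨v, v1, v2⟩ := prune_iso w hw hW (a.1 - p.1) (a.2 - p.2) h
          apply hab
          have z1 : a.1 - (p.1 + k * w.1) = (v - k) * w.1 := by linear_combination v1
          have z2 : a.2 - (p.2 + k * w.2) = (v - k) * w.2 := by linear_combination v2
          rw [z1, z2]
          linear_combination (v - k) ^ 2 * hW
      rw [hxx]
  have b2 : (((pruneQ A).filter fun t => t.2.2 ∈ C).filter
      (fun t => ¬ (w.1 ^ 2 + w.2 ^ 2 = 0 ∧ w.1 * (p.1 - t.1.1) + w.2 * (p.2 - t.1.2) = 0))).card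
      ≤ 2 * (A ×ˢ A).card := by
    refine Finset.card_le_mul_card_image_of_maps_to (f := fun t => (t.1, t.2.1)) ?_ 2 ?_
    · rintro ⟨x, a, b⟩ ht
      simp only [pruneQ, Finset.mem_filter, Finset.mem_product] at ht ⊢
      exact ⟨ht.1.1.1.1, ht.1.1.1.2.1⟩
    · rintro ⟨x, a⟩ _
      by_contra hcon
      rw [not_le, Finset.two_lt_card] at hcon
      obtain ⟨⟨x1, a1, c1⟩, h1, ⟨x2, a2, c2⟩, h2', ⟨x3, a3, c3⟩, h3, n12, n13, n23⟩ := hcon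
      simp only [pruneQ, Finset.mem_filter, Finset.mem_product, Prod.mk.injEq] at h1 h2' h3
      obtain ⟨⟨⟨⟨_, _, e1⟩, c1C⟩, hn⟩, rfl, rfl⟩ := h1
      obtain ⟨⟨⟨⟨_, _, e2⟩, c2C⟩, _⟩, rfl, rfl⟩ := h2'
      obtain ⟨⟨⟨⟨_, _, e3⟩, c3C⟩, _⟩, rfl, rfl⟩ := h3
      obtain ⟨k1, rfl⟩ := hC _ c1C
      obtain ⟨k2, rfl⟩ := hC _ c2C
      obtain ⟨k3, rfl⟩ := hC _ c3C
      have k12 : k1 - k2 ≠ 0 := fun h => n12 (by rw [sub_eq_zero.1 h])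
      have k13 : k1 - k3 ≠ 0 := fun h => n13 (by rw [sub_eq_zero.1 h])
      have k23 : k2 - k3 ≠ 0 := fun h => n23 (by rw [sub_eq_zero.1 h])
      simp only [dist2] at e1 e2 e3
      have f1 : (w.1 ^ 2 + w.2 ^ 2) * (k1 + k2)
          + 2 * (w.1 * (p.1 - x3.1) + w.2 * (p.2 - x3.2)) = 0 := by
        apply mul_left_cancel₀ k12
        linear_combination e2 - e1
      have f2 : (w.1 ^ 2 + w.2 ^ 2) * (k1 + k3)
          + 2 * (w.1 * (p.1 - x3.1) + w.2 * (p.2 - x3.2)) = 0 := by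
        apply mul_left_cancel₀ k13
        linear_combination e3 - e1
      have hW : w.1 ^ 2 + w.2 ^ 2 = 0 := by
        apply mul_left_cancel₀ k23
        linear_combination f1 - f2
      refine hn ⟨hW, ?_⟩
      apply mul_left_cancel₀ h2
      rw [hW] at f1
      linear_combination f1
  rw [Finset.card_product] at b1 b2
  nlinarith

/-- Triples with first point on the line. -/
lemma prune_first (h2 : (2 : F) ≠ 0) (A C : Finset (F × F)) (p w : F × F) (hw : w ≠ 0)
    (hC : ∀ c ∈ C, ∃ k : F, c = (p.1 + k * w.1, p.2 + k * w.2)) :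
    ((pruneQ A).filter fun t => t.1 ∈ C).card ≤ 2 * A.card ^ 2 := by
  have hw' : w.1 ≠ 0 ∨ w.2 ≠ 0 := by
    by_contra hcon
    push Not at hcon
    exact hw (Prod.ext hcon.1 hcon.2)
  rw [← Finset.card_filter_add_card_filter_not (s := (pruneQ A).filter fun t => t.1 ∈ C)
    (fun t => w.1 * (t.2.1.1 - t.2.2.1) + w.2 * (t.2.1.2 - t.2.2.2) = 0)]
  have b1 : (((pruneQ A).filter fun t => t.1 ∈ C).filter
      (fun t => w.1 * (t.2.1.1 - t.2.2.1) + w.2 * (t.2.1.2 - t.2.2.2) = 0)).card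
      ≤ (A ×ˢ A).card := by
    refine Finset.card_le_card_of_injOn (fun t => (t.1, t.2.1)) ?_ ?_
    · rintro ⟨x, a, b⟩ ht
      simp only [pruneQ, Finset.coe_filter, Finset.mem_filter, Finset.mem_product,
        Set.mem_ofPred_eq] at ht
      simp only [Finset.coe_product, Set.mem_prod, Finset.mem_coe]
      exact ⟨ht.1.1.1.1, ht.1.1.1.2.1⟩
    · rintro ⟨x, a, b⟩ ht ⟨x', a', c⟩ ht' heq
      simp only [Prod.mk.injEq] at heq
      obtain ⟨rfl, rfl⟩ := heq
      simp only [pruneQ, Finset.coe_filter, Finset.mem_filter, Finset.mem_product,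
        Set.mem_ofPred_eq] at ht ht'
      obtain ⟨⟨⟨_, hab, hx⟩, _⟩, hu⟩ := ht
      obtain ⟨⟨⟨_, hac, hx'⟩, _⟩, hu'⟩ := ht'
      have : b = c := by
        obtain ⟨x1, x2⟩ := x
        obtain ⟨a1, a2⟩ := a
        obtain ⟨b1, b2⟩ := b
        obtain ⟨c1, c2⟩ := c
        obtain ⟨w1, w2⟩ := w
        simp only [dist2] at *
        have hpar : (a1 - b1) * (a2 - c2) = (a2 - b2) * (a1 - c1) := by
          rcases hw' with h | h
          · apply mul_left_cancel₀ h
            linear_combination (a2 - c2) * hu - (a2 - b2) * hu'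
          · apply mul_left_cancel₀ h
            linear_combination (a1 - b1) * hu' - (a1 - c1) * hu
        refine prune_uniq h2 (a1, a2) (b1, b2) (c1, c2) hab hac ?_
        rintro ⟨y1, y2⟩ _ hy
        simp only [dist2] at *
        have hd : 2 * ((a1 - b1) * (y1 - x1) + (a2 - b2) * (y2 - x2)) = 0 := by
          linear_combination hx - hy
        have hd' := (mul_eq_zero.1 hd).resolve_left h2
        have hnb : a1 - b1 ≠ 0 ∨ a2 - b2 ≠ 0 := by
          by_contra hcon
          push Not at hcon
          apply hab
          rw [hcon.1, hcon.2]; ring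
        have hz : (a1 - c1) * (y1 - x1) + (a2 - c2) * (y2 - x2) = 0 := by
          rcases hnb with h | h
          · apply mul_left_cancel₀ h
            linear_combination (a1 - c1) * hd' + (y2 - x2) * hpar
          · apply mul_left_cancel₀ h
            linear_combination (a2 - c2) * hd' - (y1 - x1) * hpar
        linear_combination hx' - 2 * hz
      rw [this]
  have b2 : (((pruneQ A).filter fun t => t.1 ∈ C).filter
      (fun t => ¬ (w.1 * (t.2.1.1 - t.2.2.1) + w.2 * (t.2.1.2 - t.2.2.2) = 0))).card
      ≤ (A ×ˢ A).card := by
    refine Finset.card_le_card_of_injOn (fun t => t.2) ?_ ?_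
    · rintro ⟨x, a, b⟩ ht
      simp only [pruneQ, Finset.coe_filter, Finset.mem_filter, Finset.mem_product,
        Set.mem_ofPred_eq] at ht
      simp only [Finset.coe_product, Set.mem_prod, Finset.mem_coe]
      exact ht.1.1.1.2
    · rintro ⟨x, a, b⟩ ht ⟨x', a', b'⟩ ht' heq
      simp only [Prod.mk.injEq] at heq
      obtain ⟨rfl, rfl⟩ := heq
      simp only [pruneQ, Finset.coe_filter, Finset.mem_filter, Finset.mem_product,
        Set.mem_ofPred_eq] at ht ht'
      obtain ⟨⟨⟨_, hab, hx⟩, hxC⟩, hu⟩ := ht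
      obtain ⟨⟨⟨_, _, hx'⟩, hxC'⟩, _⟩ := ht'
      obtain ⟨k, rfl⟩ := hC x hxC
      obtain ⟨k', rfl⟩ := hC x' hxC'
      simp only [dist2] at hx hx'
      have h3 : 2 * ((k - k') * (w.1 * (a.1 - b.1) + w.2 * (a.2 - b.2))) = 0 := by
        linear_combination hx' - hx
      have h4 := (mul_eq_zero.1 ((mul_eq_zero.1 h3).resolve_left h2)).resolve_right hu
      rw [sub_eq_zero.1 h4]
  rw [Finset.card_product] at b1 b2
  nlinarith

lemma prune_dist_comm (x y : F × F) : dist2 x y = dist2 y x := by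
  simp only [dist2]; ring

/-- Triples with second point on the line: swap. -/
lemma prune_second (h2 : (2 : F) ≠ 0) (A C : Finset (F × F)) (p w : F × F) (hw : w ≠ 0)
    (hC : ∀ c ∈ C, ∃ k : F, c = (p.1 + k * w.1, p.2 + k * w.2)) :
    ((pruneQ A).filter fun t => t.2.1 ∈ C).card ≤ 3 * A.card ^ 2 := by
  refine le_trans ?_ (prune_third h2 A C p w hw hC)
  refine Finset.card_le_card_of_injOn (fun t => (t.1, t.2.2, t.2.1)) ?_ ?_
  · rintro ⟨x, a, b⟩ ht
    simp only [pruneQ, Finset.coe_filter, Finset.mem_filter, Finset.mem_product,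
      Set.mem_ofPred_eq] at ht ⊢
    obtain ⟨⟨⟨hx, ha, hb⟩, hab, he⟩, hc⟩ := ht
    exact ⟨⟨⟨hx, hb, ha⟩, by rwa [prune_dist_comm], he.symm⟩, hc⟩
  · rintro ⟨x, a, b⟩ _ ⟨x', a', b'⟩ _ heq
    simp only [Prod.mk.injEq] at heq ⊢
    tauto

end PruningHelpers


/-- Pruning a line: removing the points of `A` on a single line `γ` decreases
`T` by at most `8|A|²`. -/
theorem pruning_heavy_lines (F : Type*) [Field F] (hchar : (2 : F) ≠ 0)
    (A B C : Finset (F × F)) (hdisj : Disjoint B C) (hunion : A = B ∪ C)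
    (p w : F × F) (hw : w ≠ 0)
    (hC : ∀ c ∈ C, ∃ k : F, c = (p.1 + k * w.1, p.2 + k * w.2)) :
    Tsum A ≤ Tsum B + 8 * A.card ^ 2 := by
  rw [prune_T_eq hchar, prune_T_eq hchar]
  have hsub : pruneQ A ⊆ pruneQ B ∪ (((pruneQ A).filter fun t => t.1 ∈ C) ∪
      (((pruneQ A).filter fun t => t.2.1 ∈ C) ∪ ((pruneQ A).filter fun t => t.2.2 ∈ C))) := by
    rintro ⟨x, a, b⟩ ht
    have ht' := ht
    simp only [pruneQ, Finset.mem_filter, Finset.mem_product] at ht'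
    obtain ⟨⟨hx, ha, hb⟩, hr⟩ := ht'
    by_cases cx : x ∈ C
    · exact Finset.mem_union_right _ (Finset.mem_union_left _ (Finset.mem_filter.2 ⟨ht, cx⟩))
    by_cases ca : a ∈ C
    · exact Finset.mem_union_right _ (Finset.mem_union_right _
        (Finset.mem_union_left _ (Finset.mem_filter.2 ⟨ht, ca⟩)))
    by_cases cb : b ∈ C
    · exact Finset.mem_union_right _ (Finset.mem_union_right _
        (Finset.mem_union_right _ (Finset.mem_filter.2 ⟨ht, cb⟩)))
    have hB : ∀ y, y ∈ A → y ∉ C → y ∈ B := fun y hy hc => by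
      rw [hunion] at hy
      exact (Finset.mem_union.1 hy).resolve_right hc
    refine Finset.mem_union_left _ ?_
    simp only [pruneQ, Finset.mem_filter, Finset.mem_product]
    exact ⟨⟨hB x hx cx, hB a ha ca, hB b hb cb⟩, hr⟩
  have h0 := Finset.card_le_card hsub
  have h1 := Finset.card_union_le (pruneQ B) (((pruneQ A).filter fun t => t.1 ∈ C) ∪
      (((pruneQ A).filter fun t => t.2.1 ∈ C) ∪ ((pruneQ A).filter fun t => t.2.2 ∈ C)))
  have h2 := Finset.card_union_le ((pruneQ A).filter fun t => t.1 ∈ C)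
      (((pruneQ A).filter fun t => t.2.1 ∈ C) ∪ ((pruneQ A).filter fun t => t.2.2 ∈ C))
  have h3 := Finset.card_union_le
      ((pruneQ A).filter fun t => t.2.1 ∈ C) ((pruneQ A).filter fun t => t.2.2 ∈ C)
  have b1 := prune_first hchar A C p w hw hC
  have b2 := prune_second hchar A C p w hw hC
  have b3 := prune_third hchar A C p w hw hC
  omega
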